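/- Let (X,T) be a topological dynamical system whose nonlinear topological pressure P(T,ℰ) is finite, where ℰ is an energy. Then P(T,ℰ) = sup over finite open covers 𝒰 of X of inf over finite Borel covers, namely P(T,ℰ) = sup_{𝒰 ∈ 𝒞_X^o} limsup_{n→∞} (1/n) log p²_n(T,ℰ;𝒰), where p²_n(T,ℰ;𝒰) = inf { ∑_{V∈𝒱} inf_{x∈V} e^{nℰ(Δ_x^n)} : 𝒱 a finite Borel cover refining 𝒰_0^{n-1} }. -/

import Mathlib

open MeasureTheory Filter Set
open scoped ENNReal NNReal Classical

set_option linter.unusedSectionVars false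

variable {X : Type*} [MetricSpace X] [CompactSpace X] [MeasurableSpace X] [BorelSpace X]

/-- The empirical measure `Δ_x^n = (1/n) ∑_{i<n} δ_{T^i x}` as a `Measure`. -/
noncomputable def empMeas (T : X → X) (n : ℕ) (x : X) : Measure X :=
  (n : ℝ≥0∞)⁻¹ • ∑ i ∈ Finset.range n, Measure.dirac (T^[i] x)

theorem empMeas_prob (T : X → X) {n : ℕ} (hn : n ≠ 0) (x : X) :
    IsProbabilityMeasure (empMeas T n x) := by
  constructor
  simp only [empMeas, Measure.smul_apply, smul_eq_mul, Measure.finset_sum_apply,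
    measure_univ, Finset.sum_const, Finset.card_range, nsmul_eq_mul, mul_one]
  exact ENNReal.inv_mul_cancel (by exact_mod_cast hn) (by simp)

/-- The empirical measure as a probability measure (junk value `δ_x` for `n = 0`). -/
noncomputable def empPM (T : X → X) (n : ℕ) (x : X) : ProbabilityMeasure X :=
  if hn : n = 0 then ⟨Measure.dirac x, inferInstance⟩
  else ⟨empMeas T n x, empMeas_prob T hn x⟩

/-- The weight `e^{n ℰ(Δ_x^n)}`. -/
noncomputable def wt (T : X → X) (ℰ : ProbabilityMeasure X → ℝ) (n : ℕ) (x : X) : ℝ :=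
  Real.exp (n * ℰ (empPM T n x))

/-- Kantorovich–Rubinstein (Wasserstein-1) distance. -/
noncomputable def Wass (μ ν : Measure X) : ℝ :=
  sSup {r | ∃ g : X → ℝ, LipschitzWith 1 g ∧ r = (∫ x, g x ∂μ) - ∫ x, g x ∂ν}

/-- The dynamical join `𝒰_0^{n-1} = ⋁_{i=0}^{n-1} T^{-i} 𝒰`. -/
noncomputable def joinF (T : X → X) (𝒰 : Finset (Set X)) (n : ℕ) : Finset (Set X) :=
  (Fintype.piFinset fun _ : Fin n => 𝒰).image fun u => ⋂ i : Fin n, T^[(i : ℕ)] ⁻¹' u i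

def IsBorelCover (𝒱 : Finset (Set X)) : Prop :=
  (∀ V ∈ 𝒱, MeasurableSet V) ∧ ⋃₀ (𝒱 : Set (Set X)) = univ

def IsOpenCover (𝒰 : Finset (Set X)) : Prop :=
  (∀ U ∈ 𝒰, IsOpen U) ∧ ⋃₀ (𝒰 : Set (Set X)) = univ

/-- `𝒱` refines `𝒲`: every element of `𝒱` is contained in some element of `𝒲`. -/
def Refines (𝒱 𝒲 : Finset (Set X)) : Prop := ∀ V ∈ 𝒱, ∃ W ∈ 𝒲, V ⊆ W

def IsPartitionF (α : Finset (Set X)) : Prop :=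
  (∀ A ∈ α, MeasurableSet A) ∧ ⋃₀ (α : Set (Set X)) = univ ∧
    ∀ A ∈ α, ∀ B ∈ α, A ≠ B → Disjoint A B

noncomputable def p1 (T : X → X) (ℰ : ProbabilityMeasure X → ℝ) (𝒰 : Finset (Set X)) (n : ℕ) : ℝ :=
  sInf {r | ∃ 𝒱 : Finset (Set X), IsBorelCover 𝒱 ∧ Refines 𝒱 (joinF T 𝒰 n) ∧
    r = ∑ V ∈ 𝒱, sSup (wt T ℰ n '' V)}

noncomputable def p2 (T : X → X) (ℰ : ProbabilityMeasure X → ℝ) (𝒰 : Finset (Set X)) (n : ℕ) : ℝ :=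
  sInf {r | ∃ 𝒱 : Finset (Set X), IsBorelCover 𝒱 ∧ Refines 𝒱 (joinF T 𝒰 n) ∧
    r = ∑ V ∈ 𝒱, sInf (wt T ℰ n '' V)}

noncomputable def p3 (T : X → X) (ℰ : ProbabilityMeasure X → ℝ) (𝒰 : Finset (Set X)) (n : ℕ) : ℝ :=
  sInf {r | ∃ β : Finset (Set X), β ⊆ joinF T 𝒰 n ∧ ⋃₀ (β : Set (Set X)) = univ ∧
    r = ∑ B ∈ β, sSup (wt T ℰ n '' B)}

noncomputable def p4 (T : X → X) (ℰ : ProbabilityMeasure X → ℝ) (𝒰 : Finset (Set X)) (n : ℕ) : ℝ :=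
  sInf {r | ∃ β : Finset (Set X), β ⊆ joinF T 𝒰 n ∧ ⋃₀ (β : Set (Set X)) = univ ∧
    r = ∑ B ∈ β, sInf (wt T ℰ n '' B)}

/-- `E` is an `(n,ε)`-separated set. -/
def IsSeparated (T : X → X) (n : ℕ) (ε : ℝ) (E : Finset X) : Prop :=
  ∀ x ∈ E, ∀ y ∈ E, x ≠ y → ∃ i < n, ε ≤ dist (T^[i] x) (T^[i] y)

/-- `F` is an `(n,ε)`-spanning set. -/
def IsSpanning (T : X → X) (n : ℕ) (ε : ℝ) (F : Finset X) : Prop :=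
  ∀ x : X, ∃ y ∈ F, ∀ i < n, dist (T^[i] x) (T^[i] y) < ε

noncomputable def Pn (T : X → X) (ℰ : ProbabilityMeasure X → ℝ) (n : ℕ) (ε : ℝ) : ℝ :=
  sSup {r | ∃ E : Finset X, IsSeparated T n ε E ∧ r = ∑ x ∈ E, wt T ℰ n x}

noncomputable def Qn (T : X → X) (ℰ : ProbabilityMeasure X → ℝ) (n : ℕ) (ε : ℝ) : ℝ :=
  sInf {r | ∃ F : Finset X, IsSpanning T n ε F ∧ r = ∑ x ∈ F, wt T ℰ n x}

/-- `τ_ε`, modulus of continuity of the energy w.r.t. the Wasserstein distance. -/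
noncomputable def tauE (ℰ : ProbabilityMeasure X → ℝ) (ε : ℝ) : ℝ :=
  sSup {r | ∃ μ ν : ProbabilityMeasure X, Wass (μ : Measure X) (ν : Measure X) ≤ ε ∧
    r = |ℰ μ - ℰ ν|}

/-- Shannon entropy of a finite collection of sets. -/
noncomputable def entF (μ : Measure X) (α : Finset (Set X)) : ℝ :=
  ∑ A ∈ α, Real.negMulLog (μ A).toReal

/-- `H_μ(𝒰)`: infimum of entropies of partitions refining `𝒰`. -/
noncomputable def Hcov (μ : Measure X) (𝒰 : Finset (Set X)) : ℝ :=
  sInf {r | ∃ α : Finset (Set X), IsPartitionF α ∧ Refines α 𝒰 ∧ r = entF μ α}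

/-- Local measure-theoretic entropy `h_μ(T,𝒰)`. -/
noncomputable def hcov (T : X → X) (μ : Measure X) (𝒰 : Finset (Set X)) : ℝ :=
  Filter.atTop.limsup fun n => Hcov μ (joinF T 𝒰 n) / n


lemma exists_abs_energy_le {ℰ : ProbabilityMeasure X → ℝ} (hE : Continuous ℰ) :
    ∃ C : ℝ, 0 ≤ C ∧ ∀ μ, |ℰ μ| ≤ C := by
  obtain ⟨C, hC⟩ := isCompact_univ.exists_bound_of_continuousOn hE.continuousOn
  exact ⟨max C 0, le_max_right _ _, fun μ => (hC μ (mem_univ μ)).trans (le_max_left _ _)⟩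

lemma empMeas_le_thickening {T : X → X} {n : ℕ} {δ : ℝ} {x y : X}
    (h : ∀ i < n, dist (T^[i] x) (T^[i] y) < δ) {B : Set X} (hB : MeasurableSet B) :
    empMeas T n x B ≤ empMeas T n y (Metric.thickening δ B) := by
  simp only [empMeas, Measure.smul_apply, smul_eq_mul, Measure.finsetSum_apply]
  refine mul_le_mul_right (Finset.sum_le_sum fun i hi => ?_) _
  rw [Measure.dirac_apply' _ hB, Measure.dirac_apply' _ Metric.isOpen_thickening.measurableSet]
  by_cases hx : T^[i] x ∈ B
  · have hy : T^[i] y ∈ Metric.thickening δ B :=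
      Metric.mem_thickening_iff.2 ⟨_, hx, by
        rw [dist_comm]; exact h i (Finset.mem_range.1 hi)⟩
    simp [hx, hy]
  · simp [hx]

/-- Orbit segments that stay uniformly close have empirical measures of nearly equal energy. -/
lemma exists_delta_energy_close {ℰ : ProbabilityMeasure X → ℝ} (hE : Continuous ℰ)
    {η : ℝ} (hη : 0 < η) :
    ∃ δ > 0, ∀ (T : X → X) (n : ℕ) (x y : X), n ≠ 0 →
      (∀ i < n, dist (T^[i] x) (T^[i] y) < δ) →
      |ℰ (empPM T n x) - ℰ (empPM T n y)| < η := by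
  let e := LevyProkhorov.probabilityMeasureHomeomorph (Ω := X)
  have : CompactSpace (LevyProkhorov (ProbabilityMeasure X)) := e.compactSpace
  have huc : UniformContinuous fun μ => ℰ (e.symm μ) :=
    CompactSpace.uniformContinuous_of_continuous (hE.comp e.symm.continuous)
  obtain ⟨δ, hδ, H⟩ := Metric.uniformContinuous_iff.1 huc η hη
  refine ⟨δ / 2, half_pos hδ, fun T n x y hn h => ?_⟩
  have hd : dist (e (empPM T n x)) (e (empPM T n y)) < δ := by
    refine lt_of_le_of_lt ?_ (half_lt_self hδ)
    have := empMeas_prob T hn x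
    have := empMeas_prob T hn y
    have hx : ((empPM T n x : ProbabilityMeasure X) : Measure X) = empMeas T n x := by
      simp [empPM, hn]
    have hy : ((empPM T n y : ProbabilityMeasure X) : Measure X) = empMeas T n y := by
      simp [empPM, hn]
    have key : levyProkhorovDist (empPM T n x : Measure X) (empPM T n y : Measure X) ≤ δ / 2 := by
      rw [hx, hy]
      refine levyProkhorovDist_le_of_forall_le _ _ (half_pos hδ).le fun ε B hε hB => ?_
      refine (empMeas_le_thickening h hB).trans ?_
      refine (measure_mono (Metric.thickening_mono hε.le B)).trans ?_
      exact le_self_add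
    exact key
  simpa [Real.dist_eq] using H hd

lemma wt_pos (T : X → X) (ℰ : ProbabilityMeasure X → ℝ) (n : ℕ) (x : X) : 0 < wt T ℰ n x :=
  Real.exp_pos _

lemma exp_neg_le_wt {ℰ : ProbabilityMeasure X → ℝ} {C : ℝ} (hC : ∀ μ, |ℰ μ| ≤ C)
    (T : X → X) (n : ℕ) (x : X) : Real.exp (n * -C) ≤ wt T ℰ n x := by
  unfold wt
  gcongr
  exact neg_le_of_abs_le (hC _)

lemma wt_le_exp {ℰ : ProbabilityMeasure X → ℝ} {C : ℝ} (hC : ∀ μ, |ℰ μ| ≤ C)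
    (T : X → X) (n : ℕ) (x : X) : wt T ℰ n x ≤ Real.exp (n * C) := by
  unfold wt
  gcongr
  exact le_of_abs_le (hC _)

lemma bddBelow_wt_image (T : X → X) (ℰ : ProbabilityMeasure X → ℝ) (n : ℕ) (V : Set X) :
    BddBelow (wt T ℰ n '' V) :=
  ⟨0, by rintro _ ⟨x, -, rfl⟩; exact (wt_pos T ℰ n x).le⟩

lemma sInf_wt_image_nonneg (T : X → X) (ℰ : ProbabilityMeasure X → ℝ) (n : ℕ) (V : Set X) :
    0 ≤ sInf (wt T ℰ n '' V) :=
  Real.sInf_nonneg (by rintro _ ⟨x, -, rfl⟩; exact (wt_pos T ℰ n x).le)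

/-- The cardinality of `(n,ε)`-separated sets grows at most exponentially in `n`. -/
lemma exists_card_separated_le {ε : ℝ} (hε : 0 < ε) :
    ∃ N : ℕ, 0 < N ∧ ∀ (T : X → X) (n : ℕ) (E : Finset X), IsSeparated T n ε E → E.card ≤ N ^ n := by
  obtain ⟨t, -, htf, ht⟩ := Metric.finite_approx_of_totallyBounded
    (isCompact_univ (X := X)).totallyBounded (ε / 2) (half_pos hε)
  have hc : ∀ x : X, ∃ c ∈ htf.toFinset, dist x c < ε / 2 := fun x => by
    simpa using ht (mem_univ x)
  choose c hct hcd using hc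
  refine ⟨htf.toFinset.card + 1, Nat.succ_pos _, fun T n E hE => ?_⟩
  calc E.card ≤ (Fintype.piFinset fun _ : Fin n => htf.toFinset).card := by
        refine Finset.card_le_card_of_injOn (fun x i => c (T^[i] x)) ?_ ?_
        · intro x _
          simp only [Finset.mem_coe, Fintype.mem_piFinset]
          exact fun i => hct _
        · intro x hx y hy hxy
          by_contra hne
          obtain ⟨i, hi, hd⟩ := hE x hx y hy hne
          have hi' : c (T^[i] x) = c (T^[i] y) := congrFun hxy ⟨i, hi⟩
          have h1 := hcd (T^[i] x)
          have h2 := hcd (T^[i] y)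
          rw [← hi'] at h2
          have := dist_triangle_right (T^[i] x) (T^[i] y) (c (T^[i] x))
          linarith
    _ = htf.toFinset.card ^ n := by simp
    _ ≤ _ := Nat.pow_le_pow_left (Nat.le_succ _) n

lemma sum_wt_le_of_separated {ℰ : ProbabilityMeasure X → ℝ} {C : ℝ} (hC : ∀ μ, |ℰ μ| ≤ C)
    {ε : ℝ} {N : ℕ}
    (hN : ∀ (T : X → X) (n : ℕ) (E : Finset X), IsSeparated T n ε E → E.card ≤ N ^ n)
    {T : X → X} {n : ℕ} {E : Finset X} (hE : IsSeparated T n ε E) :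
    ∑ x ∈ E, wt T ℰ n x ≤ (N : ℝ) ^ n * Real.exp (n * C) := by
  calc ∑ x ∈ E, wt T ℰ n x ≤ E.card • Real.exp (n * C) :=
        Finset.sum_le_card_nsmul _ _ _ fun x _ => wt_le_exp hC T n x
    _ ≤ _ := by
        rw [nsmul_eq_mul]
        gcongr
        exact_mod_cast hN T n E hE

lemma sum_wt_le_Pn {ℰ : ProbabilityMeasure X → ℝ} (hE : Continuous ℰ) {T : X → X} {n : ℕ}
    {ε : ℝ} (hε : 0 < ε) {E : Finset X} (hsep : IsSeparated T n ε E) :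
    ∑ x ∈ E, wt T ℰ n x ≤ Pn T ℰ n ε := by
  obtain ⟨C, -, hC⟩ := exists_abs_energy_le hE
  obtain ⟨N, -, hN⟩ := exists_card_separated_le (X := X) hε
  refine le_csSup ⟨(N : ℝ) ^ n * Real.exp (n * C), ?_⟩ ⟨E, hsep, rfl⟩
  rintro _ ⟨F, hF, rfl⟩
  exact sum_wt_le_of_separated hC hN hF

lemma exists_separated_spanning (T : X → X) (n : ℕ) {ε : ℝ} (hε : 0 < ε) :
    ∃ E : Finset X, IsSeparated T n ε E ∧ IsSpanning T n ε E := by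
  obtain ⟨N, -, hN⟩ := exists_card_separated_le (X := X) hε
  let S : Set ℕ := {k | ∃ E : Finset X, IsSeparated T n ε E ∧ E.card = k}
  have hS : S.Nonempty := ⟨0, ∅, by simp [IsSeparated], rfl⟩
  have hSb : BddAbove S := ⟨N ^ n, by rintro _ ⟨E, hE, rfl⟩; exact hN T n E hE⟩
  obtain ⟨E, hE, hcard⟩ := Nat.sSup_mem hS hSb
  refine ⟨E, hE, fun x => ?_⟩
  by_contra! hx
  have hxE : x ∉ E := fun h => by
    obtain ⟨i, -, hi⟩ := hx x h
    rw [dist_self] at hi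
    linarith
  have hins : IsSeparated T n ε (insert x E) := by
    intro a ha b hb hab
    rcases Finset.mem_insert.1 ha with rfl | ha' <;> rcases Finset.mem_insert.1 hb with rfl | hb'
    · exact absurd rfl hab
    · exact hx b hb'
    · obtain ⟨i, hi, h⟩ := hx a ha'
      exact ⟨i, hi, by rwa [dist_comm]⟩
    · exact hE a ha' b hb' hab
  have h1 : (insert x E).card ≤ sSup S := le_csSup hSb ⟨_, hins, rfl⟩
  rw [Finset.card_insert_of_notMem hxE] at h1
  omega

/-- Every open cover admits Borel refinements of its dynamical joins (by Bowen balls) whose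
weights are controlled by separated sets at a fixed scale. -/
lemma exists_refining_cover_sum_le_Pn {T : X → X} (hT : Continuous T)
    {ℰ : ProbabilityMeasure X → ℝ} (hE : Continuous ℰ) {𝒰 : Finset (Set X)}
    (h𝒰 : IsOpenCover 𝒰) :
    ∃ δ > 0, ∀ n, ∃ 𝒱 : Finset (Set X), IsBorelCover 𝒱 ∧ Refines 𝒱 (joinF T 𝒰 n) ∧
      ∑ V ∈ 𝒱, sInf (wt T ℰ n '' V) ≤ Pn T ℰ n δ := by
  obtain ⟨δ, hδ, hleb⟩ := lebesgue_number_lemma_of_metric_sUnion (isCompact_univ (X := X))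
    (c := (𝒰 : Set (Set X))) (fun U hU => h𝒰.1 U hU) h𝒰.2.ge
  refine ⟨δ, hδ, fun n => ?_⟩
  obtain ⟨E, hsep, hspan⟩ := exists_separated_spanning T n hδ
  let B : X → Set X := fun x => ⋂ i : Fin n, T^[(i : ℕ)] ⁻¹' Metric.ball (T^[(i : ℕ)] x) δ
  refine ⟨E.image B, ⟨?_, ?_⟩, ?_, ?_⟩
  · intro V hV
    obtain ⟨x, -, rfl⟩ := Finset.mem_image.1 hV
    exact MeasurableSet.iInter fun i =>
      (Metric.isOpen_ball.preimage (hT.iterate i)).measurableSet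
  · refine eq_univ_of_forall fun y => ?_
    obtain ⟨x, hx, h⟩ := hspan y
    refine ⟨B x, Finset.mem_coe.2 (Finset.mem_image_of_mem B hx), mem_iInter.2 fun i => ?_⟩
    exact h i i.2
  · intro V hV
    obtain ⟨x, -, rfl⟩ := Finset.mem_image.1 hV
    choose u hu hsub using fun i : Fin n => hleb (T^[(i : ℕ)] x) (mem_univ _)
    refine ⟨⋂ i : Fin n, T^[(i : ℕ)] ⁻¹' u i, ?_, iInter_mono fun i => preimage_mono (hsub i)⟩
    exact Finset.mem_image.2 ⟨u, Fintype.mem_piFinset.2 hu, rfl⟩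
  · calc ∑ V ∈ E.image B, sInf (wt T ℰ n '' V) ≤ ∑ x ∈ E, sInf (wt T ℰ n '' B x) :=
          Finset.sum_image_le_of_nonneg fun V _ => sInf_wt_image_nonneg T ℰ n V
      _ ≤ ∑ x ∈ E, wt T ℰ n x := Finset.sum_le_sum fun x _ =>
          csInf_le (bddBelow_wt_image T ℰ n _)
            ⟨x, mem_iInter.2 fun i => Metric.mem_ball_self hδ, rfl⟩
      _ ≤ Pn T ℰ n δ := sum_wt_le_Pn hE hδ hsep

lemma exists_p2_le_Pn {T : X → X} (hT : Continuous T) {ℰ : ProbabilityMeasure X → ℝ}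
    (hE : Continuous ℰ) {𝒰 : Finset (Set X)} (h𝒰 : IsOpenCover 𝒰) :
    ∃ δ > 0, ∀ n, p2 T ℰ 𝒰 n ≤ Pn T ℰ n δ := by
  obtain ⟨δ, hδ, h⟩ := exists_refining_cover_sum_le_Pn hT hE h𝒰
  refine ⟨δ, hδ, fun n => ?_⟩
  obtain ⟨𝒱, hb, hr, hle⟩ := h n
  refine le_trans (csInf_le ⟨0, ?_⟩ ⟨𝒱, hb, hr, rfl⟩) hle
  rintro _ ⟨𝒲, -, -, rfl⟩
  exact Finset.sum_nonneg fun V _ => sInf_wt_image_nonneg T ℰ n V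

lemma exists_openCover_dist_lt {ε : ℝ} (hε : 0 < ε) :
    ∃ 𝒰 : Finset (Set X), IsOpenCover 𝒰 ∧ ∀ U ∈ 𝒰, ∀ x ∈ U, ∀ y ∈ U, dist x y < ε := by
  obtain ⟨t, -, htf, ht⟩ := Metric.finite_approx_of_totallyBounded
    (isCompact_univ (X := X)).totallyBounded (ε / 2) (half_pos hε)
  refine ⟨htf.toFinset.image fun c => Metric.ball c (ε / 2), ⟨?_, ?_⟩, ?_⟩
  · intro U hU
    obtain ⟨c, -, rfl⟩ := Finset.mem_image.1 hU
    exact Metric.isOpen_ball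
  · simpa using univ_subset_iff.1 ht
  · intro U hU x hx y hy
    obtain ⟨c, -, rfl⟩ := Finset.mem_image.1 hU
    have := dist_triangle_right x y c
    rw [Metric.mem_ball] at hx hy
    linarith

lemma exists_openCover_Pn_le {T : X → X} (hT : Continuous T) {ℰ : ProbabilityMeasure X → ℝ}
    (hE : Continuous ℰ) {ε η : ℝ} (hε : 0 < ε) (hη : 0 < η) :
    ∃ 𝒰 : Finset (Set X), IsOpenCover 𝒰 ∧
      ∀ n : ℕ, n ≠ 0 → Pn T ℰ n ε ≤ Real.exp (n * η) * p2 T ℰ 𝒰 n := by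
  obtain ⟨δ, hδ, hclose⟩ := exists_delta_energy_close hE hη
  obtain ⟨𝒰, h𝒰, hdiam⟩ := exists_openCover_dist_lt (X := X) (lt_min hε hδ)
  refine ⟨𝒰, h𝒰, fun n hn => ?_⟩
  refine csSup_le ⟨_, ∅, by simp [IsSeparated], rfl⟩ ?_
  rintro _ ⟨E, hsep, rfl⟩
  rw [← div_le_iff₀' (Real.exp_pos _)]
  obtain ⟨_, _, h⟩ := exists_refining_cover_sum_le_Pn hT hE h𝒰
  obtain ⟨𝒱₀, hb₀, hr₀, -⟩ := h n
  refine le_csInf ⟨_, 𝒱₀, hb₀, hr₀, rfl⟩ ?_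
  rintro _ ⟨𝒱, hb, hr, rfl⟩
  rw [div_le_iff₀' (Real.exp_pos _)]
  have hdist : ∀ V ∈ 𝒱, ∀ x ∈ V, ∀ y ∈ V, ∀ i < n,
      dist (T^[i] x) (T^[i] y) < min ε δ := by
    intro V hV x hx y hy i hi
    obtain ⟨W, hW, hVW⟩ := hr V hV
    obtain ⟨u, hu, rfl⟩ := Finset.mem_image.1 hW
    exact hdiam (u ⟨i, hi⟩) (Fintype.mem_piFinset.1 hu _) _ (mem_iInter.1 (hVW hx) ⟨i, hi⟩) _
      (mem_iInter.1 (hVW hy) ⟨i, hi⟩)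
  have hmem : ∀ x : X, ∃ V ∈ 𝒱, x ∈ V := fun x => by
    have : x ∈ ⋃₀ (𝒱 : Set (Set X)) := hb.2 ▸ mem_univ x
    simpa using this
  choose f hf𝒱 hxf using hmem
  have hinj : InjOn f E := by
    intro x hx y hy hxy
    by_contra hne
    obtain ⟨i, hi, hd⟩ := hsep x hx y hy hne
    have := hdist (f x) (hf𝒱 x) x (hxf x) y (hxy ▸ hxf y) i hi
    exact absurd (this.trans_le (min_le_left _ _)) hd.not_gt
  calc ∑ x ∈ E, wt T ℰ n x
      ≤ ∑ x ∈ E, Real.exp (n * η) * sInf (wt T ℰ n '' f x) := by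
        refine Finset.sum_le_sum fun x _ => ?_
        rw [← div_le_iff₀' (Real.exp_pos _)]
        refine le_csInf ⟨_, x, hxf x, rfl⟩ ?_
        rintro _ ⟨y, hy, rfl⟩
        rw [div_le_iff₀' (Real.exp_pos _), wt, wt, ← Real.exp_add, ← mul_add]
        gcongr
        have := hclose T n x y hn fun i hi =>
          (hdist (f x) (hf𝒱 x) x (hxf x) y hy i hi).trans_le (min_le_right _ _)
        linarith [le_of_abs_le this.le]
    _ = Real.exp (n * η) * ∑ V ∈ E.image f, sInf (wt T ℰ n '' V) := by
        rw [← Finset.mul_sum, Finset.sum_image hinj]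
    _ ≤ Real.exp (n * η) * ∑ V ∈ 𝒱, sInf (wt T ℰ n '' V) := by
        gcongr
        · exact fun V _ _ => sInf_wt_image_nonneg T ℰ n V
        · exact Finset.image_subset_iff.2 fun x _ => hf𝒱 x

lemma exp_neg_le_p2 [Nonempty X] {T : X → X} (hT : Continuous T) {ℰ : ProbabilityMeasure X → ℝ}
    (hE : Continuous ℰ) {C : ℝ} (hC : ∀ μ, |ℰ μ| ≤ C) {𝒰 : Finset (Set X)}
    (h𝒰 : IsOpenCover 𝒰) (n : ℕ) : Real.exp (n * -C) ≤ p2 T ℰ 𝒰 n := by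
  obtain ⟨_, _, h⟩ := exists_refining_cover_sum_le_Pn hT hE h𝒰
  obtain ⟨𝒱₀, hb₀, hr₀, -⟩ := h n
  refine le_csInf ⟨_, 𝒱₀, hb₀, hr₀, rfl⟩ ?_
  rintro _ ⟨𝒱, hb, -, rfl⟩
  obtain ⟨x⟩ := ‹Nonempty X›
  obtain ⟨V, hV, hx⟩ : x ∈ ⋃₀ (𝒱 : Set (Set X)) := hb.2 ▸ mem_univ x
  calc Real.exp (n * -C) ≤ sInf (wt T ℰ n '' V) := by
        refine le_csInf ⟨_, x, hx, rfl⟩ ?_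
        rintro _ ⟨y, -, rfl⟩
        exact exp_neg_le_wt hC T n y
    _ ≤ _ := Finset.single_le_sum (f := fun V => sInf (wt T ℰ n '' V))
        (fun V _ => sInf_wt_image_nonneg T ℰ n V) hV

lemma exp_neg_le_Pn [Nonempty X] {T : X → X} {ℰ : ProbabilityMeasure X → ℝ}
    (hE : Continuous ℰ) {C : ℝ} (hC : ∀ μ, |ℰ μ| ≤ C) {ε : ℝ} (hε : 0 < ε) (n : ℕ) :
    Real.exp (n * -C) ≤ Pn T ℰ n ε := by
  obtain ⟨x⟩ := ‹Nonempty X›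
  have hsep : IsSeparated T n ε {x} := by simp [IsSeparated]
  have := sum_wt_le_Pn hE hε hsep
  rw [Finset.sum_singleton] at this
  exact (exp_neg_le_wt hC T n x).trans this

lemma neg_le_log_div {C r : ℝ} (hC : 0 ≤ C) {n : ℕ} (h : Real.exp (n * -C) ≤ r) :
    -C ≤ Real.log r / n := by
  rcases Nat.eq_zero_or_pos n with rfl | hn
  · simpa using hC
  · have hn' : (0 : ℝ) < n := by exact_mod_cast hn
    rw [le_div_iff₀' hn']
    exact (Real.le_log_iff_exp_le ((Real.exp_pos _).trans_le h)).2 h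

lemma isBoundedUnder_log_Pn_div [Nonempty X] {T : X → X} {ℰ : ProbabilityMeasure X → ℝ}
    (hE : Continuous ℰ) {ε : ℝ} (hε : 0 < ε) :
    IsBoundedUnder (· ≤ ·) atTop fun n : ℕ => Real.log (Pn T ℰ n ε) / n := by
  obtain ⟨C, hC0, hC⟩ := exists_abs_energy_le hE
  obtain ⟨N, hN0, hN⟩ := exists_card_separated_le (X := X) hε
  refine isBoundedUnder_of_eventually_le (a := Real.log N + C) ?_
  filter_upwards [eventually_gt_atTop 0] with n hn
  have hn' : (0 : ℝ) < n := by exact_mod_cast hn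
  have hN' : (0 : ℝ) < N := by exact_mod_cast hN0
  rw [div_le_iff₀' hn']
  have hle : Pn T ℰ n ε ≤ (N : ℝ) ^ n * Real.exp (n * C) := by
    refine csSup_le ⟨_, ∅, by simp [IsSeparated], rfl⟩ ?_
    rintro _ ⟨E, hsep, rfl⟩
    exact sum_wt_le_of_separated hC hN hsep
  calc Real.log (Pn T ℰ n ε) ≤ Real.log ((N : ℝ) ^ n * Real.exp (n * C)) :=
        Real.log_le_log ((Real.exp_pos _).trans_le (exp_neg_le_Pn hE hC hε n)) hle
    _ = n * (Real.log N + C) := by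
        rw [Real.log_mul (by positivity) (Real.exp_pos _).ne', Real.log_pow, Real.log_exp]
        ring

lemma Pn_eq_zero_of_isEmpty [IsEmpty X] (T : X → X) (ℰ : ProbabilityMeasure X → ℝ) (n : ℕ)
    (ε : ℝ) : Pn T ℰ n ε = 0 := by
  refine le_antisymm (Real.sSup_le ?_ le_rfl) (Real.sSup_nonneg ?_) <;>
  · rintro _ ⟨E, -, rfl⟩
    simp [Finset.eq_empty_of_isEmpty E]

lemma p2_eq_zero_of_isEmpty [IsEmpty X] (T : X → X) (ℰ : ProbabilityMeasure X → ℝ)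
    (𝒰 : Finset (Set X)) (n : ℕ) : p2 T ℰ 𝒰 n = 0 := by
  have h : ∀ r ∈ {r | ∃ 𝒱 : Finset (Set X), IsBorelCover 𝒱 ∧ Refines 𝒱 (joinF T 𝒰 n) ∧
      r = ∑ V ∈ 𝒱, sInf (wt T ℰ n '' V)}, r = 0 := by
    rintro _ ⟨𝒱, -, -, rfl⟩
    exact Finset.sum_eq_zero fun V _ => by simp [eq_empty_of_isEmpty V]
  exact le_antisymm (Real.sInf_nonpos fun r hr => (h r hr).le)
    (Real.sInf_nonneg fun r hr => (h r hr).ge)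

/-- the nonlinear topological pressure equals the supremum over finite
open covers of the local pressure `P₂(T,ℰ;𝒰)`. -/
theorem pressure_eq_sup_p2 (T : X → X) (hT : Continuous T)
    (ℰ : ProbabilityMeasure X → ℝ) (hE : Continuous ℰ)
    (hfin : BddAbove {r | ∃ ε : ℝ, 0 < ε ∧
      r = Filter.atTop.limsup fun n => Real.log (Pn T ℰ n ε) / n}) :
    sSup {r | ∃ ε : ℝ, 0 < ε ∧
        r = Filter.atTop.limsup fun n => Real.log (Pn T ℰ n ε) / n} =
      sSup {r | ∃ 𝒰 : Finset (Set X), IsOpenCover 𝒰 ∧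
        r = Filter.atTop.limsup fun n => Real.log (p2 T ℰ 𝒰 n) / n} := by
  have hcov : ∃ 𝒰 : Finset (Set X), IsOpenCover 𝒰 := by
    obtain ⟨𝒰, h𝒰, -⟩ := exists_openCover_dist_lt (X := X) one_pos
    exact ⟨𝒰, h𝒰⟩
  rcases isEmpty_or_nonempty X with hX | hX
  · simp only [Pn_eq_zero_of_isEmpty, p2_eq_zero_of_isEmpty]
    congr 1
    ext r
    exact ⟨fun ⟨_, _, hr⟩ => hcov.imp fun 𝒰 h𝒰 => ⟨h𝒰, hr⟩, fun ⟨_, _, hr⟩ => ⟨1, one_pos, hr⟩⟩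
  obtain ⟨C, hC0, hC⟩ := exists_abs_energy_le hE
  have hp2_bdd : ∀ 𝒰 : Finset (Set X), IsOpenCover 𝒰 →
      IsCoboundedUnder (· ≤ ·) atTop fun n : ℕ => Real.log (p2 T ℰ 𝒰 n) / n := fun 𝒰 h𝒰 =>
    (isBoundedUnder_of_eventually_ge (a := -C) <| Eventually.of_forall fun n =>
      neg_le_log_div hC0 (exp_neg_le_p2 hT hE hC h𝒰 n)).isCoboundedUnder_le
  have hle : ∀ 𝒰 : Finset (Set X), IsOpenCover 𝒰 → ∃ δ > 0,
      ∀ n : ℕ, Real.log (p2 T ℰ 𝒰 n) / n ≤ Real.log (Pn T ℰ n δ) / n := by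
    intro 𝒰 h𝒰
    obtain ⟨δ, hδ, h⟩ := exists_p2_le_Pn hT hE h𝒰
    refine ⟨δ, hδ, fun n => ?_⟩
    gcongr
    · exact (Real.exp_pos _).trans_le (exp_neg_le_p2 hT hE hC h𝒰 n)
    · exact h n
  have hub : ∀ r ∈ {r | ∃ 𝒰 : Finset (Set X), IsOpenCover 𝒰 ∧
      r = Filter.atTop.limsup fun n => Real.log (p2 T ℰ 𝒰 n) / n},
      r ≤ sSup {r | ∃ ε : ℝ, 0 < ε ∧
        r = Filter.atTop.limsup fun n => Real.log (Pn T ℰ n ε) / n} := by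
    rintro _ ⟨𝒰, h𝒰, rfl⟩
    obtain ⟨δ, hδ, h⟩ := hle 𝒰 h𝒰
    exact (limsup_le_limsup (Eventually.of_forall h) (hp2_bdd 𝒰 h𝒰)
      (isBoundedUnder_log_Pn_div hE hδ)).trans (le_csSup hfin ⟨δ, hδ, rfl⟩)
  refine le_antisymm (csSup_le ⟨_, 1, one_pos, rfl⟩ ?_)
    (csSup_le (hcov.elim fun 𝒰 h𝒰 => ⟨_, 𝒰, h𝒰, rfl⟩) hub)
  rintro _ ⟨ε, hε, rfl⟩
  refine le_of_forall_pos_le_add fun η hη => ?_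
  obtain ⟨𝒰, h𝒰, h⟩ := exists_openCover_Pn_le hT hE hε hη
  obtain ⟨δ, hδ, hδle⟩ := hle 𝒰 h𝒰
  have hbdd : IsBoundedUnder (· ≤ ·) atTop fun n : ℕ => Real.log (p2 T ℰ 𝒰 n) / n :=
    (isBoundedUnder_log_Pn_div hE hδ).mono_le (Eventually.of_forall hδle)
  have hPn : IsCoboundedUnder (· ≤ ·) atTop fun n : ℕ => Real.log (Pn T ℰ n ε) / n :=
    (isBoundedUnder_of_eventually_ge (a := -C) <| Eventually.of_forall fun n =>
      neg_le_log_div hC0 (exp_neg_le_Pn hE hC hε n)).isCoboundedUnder_le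
  have hstep : (atTop.limsup fun n : ℕ => Real.log (Pn T ℰ n ε) / n) ≤
      (atTop.limsup fun n : ℕ => Real.log (p2 T ℰ 𝒰 n) / n) + η := by
    rw [← limsup_add_const atTop _ η hbdd (hp2_bdd 𝒰 h𝒰)]
    refine limsup_le_limsup ?_ hPn (isBoundedUnder_le_add hbdd isBoundedUnder_const)
    filter_upwards [eventually_gt_atTop 0] with n hn
    have hn' : (0 : ℝ) < n := by exact_mod_cast hn
    have hpos : 0 < p2 T ℰ 𝒰 n := (Real.exp_pos _).trans_le (exp_neg_le_p2 hT hE hC h𝒰 n)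
    have hlog : Real.log (Pn T ℰ n ε) ≤ n * η + Real.log (p2 T ℰ 𝒰 n) := by
      rw [← Real.log_exp (n * η), ← Real.log_mul (Real.exp_pos _).ne' hpos.ne']
      exact Real.log_le_log ((Real.exp_pos _).trans_le (exp_neg_le_Pn hE hC hε n)) (h n hn.ne')
    rw [div_add' _ _ _ hn'.ne']
    gcongr
    linarith
  have hsup := le_csSup ⟨_, hub⟩ ⟨𝒰, h𝒰, rfl⟩
  linarith
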